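/- arXiv:1401.7827 — 5 statements merged into one kernel-verified Lean document; each statement's English description precedes it below -/
import Mathlib

section
/- Let G be a group, α : G → G an involutive automorphism (α ∘ α = id), and (V, ρ) a finite-dimensional irreducible complex representation of G such that the representation ρ ∘ α is isomorphic to ρ. Then there exists a linear automorphism T of V with T ∘ T = id_V and T ∘ ρ(g) = ρ(α(g)) ∘ T for all g ∈ G; moreover there are exactly two such automorphisms, namely T and −T. -/
/-- Schur's lemma: an endomorphism commuting with a family of endomorphisms of a
finite-dimensional space without proper nonzero invariant subspace is a scalar. -/
theorem exists_eq_smul_of_commute_of_irreducible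
    {K ι V : Type*} [Field K] [IsAlgClosed K] [AddCommGroup V] [Module K V]
    [FiniteDimensional K V] [Nontrivial V] (ρ : ι → V → V)
    (hirr : ∀ p : Submodule K V, (∀ i, ∀ v ∈ p, ρ i v ∈ p) → p = ⊥ ∨ p = ⊤)
    (f : Module.End K V) (hρ : ∀ i (c : K) v, ρ i (c • v) = c • ρ i v)
    (hf : ∀ i v, f (ρ i v) = ρ i (f v)) :
    ∃ c : K, ∀ v, f v = c • v := by
  obtain ⟨c, hc⟩ := Module.End.exists_eigenvalue f
  refine ⟨c, fun v => ?_⟩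
  have htop : f.eigenspace c = ⊤ := by
    refine (hirr _ fun i v hv => ?_).resolve_left hc
    rw [Module.End.mem_eigenspace_iff] at hv ⊢
    rw [hf, hv, hρ]
  exact Module.End.mem_eigenspace_iff.mp (htop ▸ Submodule.mem_top)

/-- Let `α` be an involutive automorphism of a group `G` and `(V, ρ)` a
finite-dimensional irreducible complex representation of `G` with `ρ ∘ α ≅ ρ`.
Then there is a linear automorphism `T` of `V` with `T ∘ T = id` intertwining
`ρ` and `ρ ∘ α`, and there are exactly two such automorphisms, namely `T` and `-T`. -/
theorem exists_involutive_intertwiner_of_irreducible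
    {G : Type*} [Group G] (α : G ≃* G) (hα : ∀ g, α (α g) = g)
    {V : Type*} [AddCommGroup V] [Module ℂ V] [FiniteDimensional ℂ V] [Nontrivial V]
    (ρ : G →* (V ≃ₗ[ℂ] V))
    (hirr : ∀ p : Submodule ℂ V, (∀ g : G, ∀ v ∈ p, ρ g v ∈ p) → p = ⊥ ∨ p = ⊤)
    (S : V ≃ₗ[ℂ] V) (hS : ∀ g v, S (ρ g v) = ρ (α g) (S v)) :
    ∃ T : V ≃ₗ[ℂ] V,
      (∀ v, T (T v) = v) ∧ (∀ g v, T (ρ g v) = ρ (α g) (T v)) ∧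
      (∀ T' : V ≃ₗ[ℂ] V,
        ((∀ v, T' (T' v) = v) ∧ ∀ g v, T' (ρ g v) = ρ (α g) (T' v)) →
          (∀ v, T' v = T v) ∨ (∀ v, T' v = - T v)) ∧
      ¬ (∀ v, T v = - T v) := by
  have schur (f : Module.End ℂ V) (hf : ∀ g v, f (ρ g v) = ρ g (f v)) :
      ∃ c : ℂ, ∀ v, f v = c • v :=
    exists_eq_smul_of_commute_of_irreducible (fun g => ρ g) hirr f
      (fun g c v => map_smul (ρ g) c v) hf
  obtain ⟨v₀, hv₀⟩ := exists_ne (0 : V)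
  obtain ⟨c, hc⟩ := schur (S.toLinearMap ∘ₗ S.toLinearMap) fun g v => by simp [hS, hα]
  replace hc : ∀ v, S (S v) = c • v := hc
  have hc0 : c ≠ 0 := by
    rintro rfl
    simpa [hv₀] using hc v₀
  obtain ⟨d, rfl⟩ := IsAlgClosed.exists_pow_nat_eq c (n := 2) two_pos
  have hd : d ≠ 0 := by
    rintro rfl
    simp at hc0
  have hinv : Function.Involutive (d⁻¹ • S.toLinearMap) := fun v => by
    simp only [LinearMap.smul_apply, LinearEquiv.coe_coe, map_smul, hc, smul_smul]
    rw [show d⁻¹ * (d⁻¹ * d ^ 2) = 1 by field_simp, one_smul]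
  obtain ⟨T, hT⟩ : ∃ T : V ≃ₗ[ℂ] V, ∀ v, T v = d⁻¹ • S v :=
    ⟨LinearEquiv.ofInvolutive _ hinv, fun _ => rfl⟩
  have hTT : ∀ v, T (T v) = v := fun v => by
    simpa [hT] using hinv v
  have hTρ : ∀ g v, T (ρ g v) = ρ (α g) (T v) := fun g v => by
    simp only [hT, hS, map_smul]
  refine ⟨T, hTT, hTρ, ?_, fun h => ?_⟩
  · rintro T' ⟨hT'T', hT'ρ⟩
    obtain ⟨k, hk⟩ := schur (T'.toLinearMap ∘ₗ T.toLinearMap) fun g v => by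
      simp [hTρ, hT'ρ, hα]
    have hkT : ∀ v, T' v = k • T v := fun v => by
      simpa [hTT] using hk (T v)
    have hk2 : k ^ 2 = 1 := by
      have h := hT'T' v₀
      rw [hkT, hkT, map_smul, hTT, smul_smul, ← pow_two] at h
      exact smul_left_injective ℂ hv₀ (by simpa using h)
    rcases eq_or_eq_neg_of_sq_eq_sq k 1 (by simpa using hk2) with rfl | rfl
    · exact Or.inl fun v => by simp [hkT]
    · exact Or.inr fun v => by simp [hkT]
  · have h2 : (2 : ℂ) • T v₀ = 0 := by
      rw [two_smul, ← eq_neg_iff_add_eq_zero]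
      exact h v₀
    simp [hv₀] at h2
end

section
/- Let G be a group, α : G → G an involutive automorphism (α ∘ α = id), (V, ρ) a representation of G on a complex vector space V, and T a linear automorphism of V with T ∘ T = id_V and T ∘ ρ(g) = ρ(α(g)) ∘ T for all g ∈ G. Define σ : G × ℝ × V → G × ℝ × V by σ(g, t, w) = (α(g)⁻¹, −t, T(ρ(g)⁻¹(w))). Then σ ∘ σ = id, and for all h, g ∈ G, t ∈ ℝ, w ∈ V one has σ(h g h⁻¹, t, ρ(h)(w)) = (α(h) g' α(h)⁻¹, t', ρ(α(h))(w')) where (g', t', w') = σ(g, t, w); consequently σ together with the G-action h · (g, t, w) = (h g h⁻¹, t, ρ(h)(w)) defines an action of the semidirect product G ⋊ ℤ/2 (ℤ/2 acting on G by α) on G × ℝ × V. -/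
/-- The action of `G` on `G × X × V` by conjugation on `G`, trivially on `X`, and through the
representation `ρ` on `V`. -/
def conjProdAction {G : Type*} [Group G] (X : Type*) {V : Type*} [AddCommGroup V] [Module ℂ V]
    (ρ : G →* (V ≃ₗ[ℂ] V)) : G →* Equiv.Perm (G × X × V) :=
  MonoidHom.toHomPerm
    { toFun := fun h p => (h * p.1 * h⁻¹, p.2.1, ρ h p.2.2)
      map_one' := by funext p; simp; rfl
      map_mul' := fun a b => by
        funext p
        change _ = (a * (b * p.1 * b⁻¹) * a⁻¹, p.2.1, ρ a (ρ b p.2.2))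
        simp [mul_assoc] }

/-- The homomorphism from `ℤ/2`, written multiplicatively, sending the generator to an element
of square one. -/
def involutionHom {M : Type*} [Monoid M] (s : M) (hs : s * s = 1) :
    Multiplicative (ZMod 2) →* M where
  toFun x := s ^ (Multiplicative.toAdd x).val
  map_one' := by simp
  map_mul' x y := by
    rw [← pow_add, toAdd_mul, ZMod.val_add]
    exact (pow_eq_pow_mod _ (by rw [pow_two, hs])).symm

theorem involutionHom_ofAdd_one {M : Type*} [Monoid M] (s : M) (hs : s * s = 1) :
    involutionHom s hs (Multiplicative.ofAdd 1) = s :=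
  pow_one s

/-- Let `α` be an involutive automorphism of a group `G`, `(V, ρ)` a complex
representation of `G`, and `T` a linear automorphism of `V` with `T ∘ T = id` and
`T ∘ ρ(g) = ρ(α g) ∘ T`.  Define `σ(g, t, w) = (α(g)⁻¹, -t, T(ρ(g)⁻¹ w))` on
`G × ℝ × V`.  Then `σ ∘ σ = id`, `σ` intertwines the `G`-action
`h · (g, t, w) = (h g h⁻¹, t, ρ(h) w)` via the automorphism `α`, and consequently
`σ` and this `G`-action define an action of `G ⋊ ℤ/2` on `G × ℝ × V`. -/
theorem semidirect_action_on_product_gamma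
    {G : Type*} [Group G] (α : G ≃* G) (hα : ∀ g, α (α g) = g)
    {V : Type*} [AddCommGroup V] [Module ℂ V]
    (ρ : G →* (V ≃ₗ[ℂ] V))
    (T : V ≃ₗ[ℂ] V) (hT2 : ∀ v, T (T v) = v)
    (hT : ∀ g v, T (ρ g v) = ρ (α g) (T v))
    (φ : Multiplicative (ZMod 2) →* MulAut G)
    (hφ : φ (Multiplicative.ofAdd 1) = α)
    (σ : G × ℝ × V → G × ℝ × V)
    (hσ : ∀ (g : G) (t : ℝ) (w : V), σ (g, t, w) = ((α g)⁻¹, -t, T ((ρ g)⁻¹ w))) :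
    (∀ p, σ (σ p) = p) ∧
    (∀ (h g : G) (t : ℝ) (w : V),
      σ (h * g * h⁻¹, t, ρ h w) =
        (α h * (σ (g, t, w)).1 * (α h)⁻¹, (σ (g, t, w)).2.1,
          ρ (α h) (σ (g, t, w)).2.2)) ∧
    ∃ act : (G ⋊[φ] Multiplicative (ZMod 2)) →* Equiv.Perm (G × ℝ × V),
      (∀ (h g : G) (t : ℝ) (w : V),
        act (SemidirectProduct.inl h) (g, t, w) = (h * g * h⁻¹, t, ρ h w)) ∧
      (∀ p, act (SemidirectProduct.inr (Multiplicative.ofAdd 1)) p = σ p) := by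
  have hσσ : ∀ p, σ (σ p) = p := by
    rintro ⟨g, t, w⟩
    simp only [hσ, ← map_inv ρ, hT, hα, hT2, inv_inv, map_inv α, neg_neg]
    rw [← LinearEquiv.mul_apply, ← map_mul ρ, mul_inv_cancel, map_one, LinearEquiv.coe_one, id]
  have hconj : ∀ (h g : G) (t : ℝ) (w : V),
      σ (h * g * h⁻¹, t, ρ h w) =
        (α h * (σ (g, t, w)).1 * (α h)⁻¹, (σ (g, t, w)).2.1,
          ρ (α h) (σ (g, t, w)).2.2) := by
    intro h g t w
    simp only [hσ, ← map_inv ρ, ← LinearEquiv.mul_apply, ← map_mul ρ]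
    simp [mul_assoc, hT]
  refine ⟨hσσ, hconj, ?_⟩
  let s : Equiv.Perm (G × ℝ × V) := ⟨σ, σ, hσσ, hσσ⟩
  have hs : s * s = 1 := Equiv.ext hσσ
  refine ⟨SemidirectProduct.lift (conjProdAction ℝ ρ) (involutionHom s hs) ?_, ?_, ?_⟩
  · intro x
    obtain rfl | rfl : x = 1 ∨ x = Multiplicative.ofAdd 1 := by
      revert x; decide
    · ext1 h
      simp
    · ext1 h
      have key : conjProdAction ℝ ρ (α h) * s = s * conjProdAction ℝ ρ h :=
        Equiv.ext fun ⟨g, t, w⟩ => (hconj h g t w).symm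
      have hφh : φ (Multiplicative.ofAdd 1) h = α h := by rw [hφ]
      simp only [MonoidHom.comp_apply, MulEquiv.coe_toMonoidHom, involutionHom_ofAdd_one,
        MulAut.conj_apply, hφh]
      rw [← key, mul_inv_cancel_right]
  · intro h g t w
    rw [SemidirectProduct.lift_inl]
    rfl
  · intro p
    rw [SemidirectProduct.lift_inr, involutionHom_ofAdd_one]
    rfl
end

section
/- Let G be a group, α : G → G an involutive automorphism (α ∘ α = id), (V, ρ) a representation of G on a complex vector space V, and T a linear automorphism of V with T ∘ ρ(g) = ρ(α(g)) ∘ T for all g ∈ G. Define φ : G × ℝ × V → G × ℝ × V by φ(g, t, w) = (g, t, t•w) if t < 0 and φ(g, t, w) = (g, t, −t•ρ(g)(w)) if t ≥ 0, and define τ : G × ℝ × V → G × ℝ × V by τ(g, t, w) = (α(g), t, T(w)). Then φ ∘ τ = τ ∘ φ. -/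
/-- Equivariance of the Brylinski–Zhang homomorphism in the `α`-case: with
`φ(g,t,w) = (g,t,t•w)` for `t < 0` and `(g,t,-t•ρ(g)w)` for `t ≥ 0`, and
`τ(g,t,w) = (α g, t, T w)`, one has `φ ∘ τ = τ ∘ φ`, where `T` is a linear
automorphism of `V` with `T ∘ ρ(g) = ρ(α g) ∘ T` for all `g`. -/
theorem brylinskiZhang_equivariant_alpha
    {G : Type*} [Group G] (α : G ≃* G) (hα : ∀ g, α (α g) = g)
    {V : Type*} [AddCommGroup V] [Module ℂ V]
    (ρ : G →* (V ≃ₗ[ℂ] V))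
    (T : V ≃ₗ[ℂ] V)
    (hT : ∀ g v, T (ρ g v) = ρ (α g) (T v))
    (φ τ : G × ℝ × V → G × ℝ × V)
    (hφneg : ∀ (g : G) (t : ℝ) (w : V), t < 0 → φ (g, t, w) = (g, t, (t : ℂ) • w))
    (hφpos : ∀ (g : G) (t : ℝ) (w : V), 0 ≤ t → φ (g, t, w) = (g, t, (-t : ℂ) • ρ g w))
    (hτ : ∀ (g : G) (t : ℝ) (w : V), τ (g, t, w) = (α g, t, T w)) :
    φ ∘ τ = τ ∘ φ := by
  funext ⟨g, t, w⟩
  simp only [Function.comp_apply]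
  rcases lt_or_ge t 0 with ht | ht
  · rw [hτ, hφneg _ _ _ ht, hφneg _ _ _ ht, hτ, map_smul]
  · rw [hτ, hφpos _ _ _ ht, hφpos _ _ _ ht, hτ, map_smul, hT]
end

section
/- Let G be a group, α : G → G an involutive automorphism (α ∘ α = id), (V, ρ) a representation of G on a complex vector space V, and T a linear automorphism of V with T ∘ ρ(g) = ρ(α(g)) ∘ T for all g ∈ G. Define φ : G × ℝ × V → G × ℝ × V by φ(g, t, w) = (g, t, t•w) if t < 0 and φ(g, t, w) = (g, t, −t•ρ(g)(w)) if t ≥ 0. Define σ_src(g, t, w) = (α(g)⁻¹, −t, T(w)) and σ_tgt(g, t, w) = (α(g)⁻¹, −t, T(ρ(g)⁻¹(w))). Then φ ∘ σ_src = σ_tgt ∘ φ. -/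
/-- Equivariance of the Brylinski–Zhang homomorphism in the `γ`-case: with
`φ(g,t,w) = (g,t,t•w)` for `t < 0` and `(g,t,-t•ρ(g)w)` for `t ≥ 0`,
`σ_src(g,t,w) = (α(g)⁻¹, -t, T w)` and `σ_tgt(g,t,w) = (α(g)⁻¹, -t, T (ρ(g)⁻¹ w))`,
one has `φ ∘ σ_src = σ_tgt ∘ φ`, where `T` is a linear automorphism of `V` with
`T ∘ ρ(g) = ρ(α g) ∘ T` for all `g`. -/
theorem brylinskiZhang_equivariant_gamma
    {G : Type*} [Group G] (α : G ≃* G) (hα : ∀ g, α (α g) = g)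
    {V : Type*} [AddCommGroup V] [Module ℂ V]
    (ρ : G →* (V ≃ₗ[ℂ] V))
    (T : V ≃ₗ[ℂ] V)
    (hT : ∀ g v, T (ρ g v) = ρ (α g) (T v))
    (φ σsrc σtgt : G × ℝ × V → G × ℝ × V)
    (hφneg : ∀ (g : G) (t : ℝ) (w : V), t < 0 → φ (g, t, w) = (g, t, (t : ℂ) • w))
    (hφpos : ∀ (g : G) (t : ℝ) (w : V), 0 ≤ t → φ (g, t, w) = (g, t, (-t : ℂ) • ρ g w))
    (hσsrc : ∀ (g : G) (t : ℝ) (w : V), σsrc (g, t, w) = ((α g)⁻¹, -t, T w))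
    (hσtgt : ∀ (g : G) (t : ℝ) (w : V), σtgt (g, t, w) = ((α g)⁻¹, -t, T ((ρ g)⁻¹ w))) :
    φ ∘ σsrc = σtgt ∘ φ := by
  have hinv (g : G) (w : V) : ρ (α g)⁻¹ (T w) = T ((ρ g)⁻¹ w) := by
    rw [← map_inv ρ g, hT, map_inv α]
  have hcancel (g : G) (w : V) : (ρ g)⁻¹ (ρ g w) = w := (ρ g).symm_apply_apply w
  funext ⟨g, t, w⟩
  simp only [Function.comp_apply, hσsrc]
  rcases lt_trichotomy t 0 with ht | rfl | ht
  · rw [hφpos _ _ _ (by linarith), hφneg _ _ _ ht, hσtgt, hinv, map_smul, map_smul]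
    simp
  · rw [hφpos _ _ _ (by simp), hφpos _ _ _ le_rfl, hσtgt]
    simp
  · rw [hφneg _ _ _ (by linarith), hφpos _ _ _ ht.le, hσtgt, map_smul, hcancel, map_smul]
    simp
end

section
/- Let A = ℤ[s₁, s₂, q]/(q² − 1, (q − 1)s₁) and let f : A → ℤ[z, t] be the ring homomorphism determined by s₁ ↦ z + t, s₂ ↦ z·t, q ↦ 1. Then the map ℤ[x] → A sending a polynomial p(x) to (q − 1)·p(s₂) is an injective ℤ-linear map whose image equals the kernel of f. -/
open MvPolynomial

/-- The elementary symmetric polynomials in two variables are algebraically independent. -/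
lemma injective_aeval_add_mul (R : Type*) [CommRing R] :
    Function.Injective
      (aeval (R := R) ![(X 0 + X 1 : MvPolynomial (Fin 2) R), X 0 * X 1]) := by
  have hsymm : (fun i : Fin 2 => esymm (Fin 2) R (i + 1)) = ![X 0 + X 1, X 0 * X 1] := by
    funext i
    fin_cases i
    · simp [esymm_one]
    · rw [esymm_eq_multiset_esymm, Fin.univ_val_map]
      exact Multiset.esymm_pair_two (X 0 : MvPolynomial (Fin 2) R) (X 1)
  intro p p' h
  refine esymmAlgHom_injective (σ := Fin 2) (n := 2) R (by simp) (Subtype.ext ?_)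
  rwa [esymmAlgHom_apply, esymmAlgHom_apply, hsymm]

section

variable {R A : Type*} [CommRing R] [CommRing A] [Algebra R A] {a b q : A}

lemma sub_one_mul_aeval_pair (ha : (q - 1) * a = 0) (g : MvPolynomial (Fin 2) R) :
    ∃ p : Polynomial R, (q - 1) * aeval ![a, b] g = (q - 1) * Polynomial.aeval b p := by
  induction g using MvPolynomial.induction_on with
  | C r => exact ⟨Polynomial.C r, by simp⟩
  | add g g' hg hg' =>
    obtain ⟨p, hp⟩ := hg
    obtain ⟨p', hp'⟩ := hg'
    exact ⟨p + p', by simp only [map_add, mul_add, hp, hp']⟩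
  | mul_X g i hg =>
    obtain ⟨p, hp⟩ := hg
    fin_cases i
    · refine ⟨0, ?_⟩
      simp only [map_mul, aeval_X, map_zero, Fin.zero_eta, Matrix.cons_val_zero]
      linear_combination (aeval ![a, b] g) * ha
    · refine ⟨p * Polynomial.X, ?_⟩
      simp only [map_mul, aeval_X, Polynomial.aeval_X, Fin.mk_one, Matrix.cons_val_one,
        Matrix.cons_val_fin_one]
      linear_combination b * hp

lemma exists_aeval_triple_eq (hq : q ^ 2 - 1 = 0) (ha : (q - 1) * a = 0)
    (P : MvPolynomial (Fin 3) R) :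
    ∃ (g : MvPolynomial (Fin 2) R) (p : Polynomial R),
      aeval ![a, b, q] P = aeval ![a, b] g + (q - 1) * Polynomial.aeval b p := by
  induction P using MvPolynomial.induction_on with
  | C r => exact ⟨C r, 0, by simp⟩
  | add P P' hP hP' =>
    obtain ⟨g, p, h⟩ := hP
    obtain ⟨g', p', h'⟩ := hP'
    exact ⟨g + g', p + p', by simp only [map_add, h, h']; ring⟩
  | mul_X P i hP =>
    obtain ⟨g, p, h⟩ := hP
    rw [map_mul, aeval_X, h]
    fin_cases i
    · refine ⟨g * X 0, 0, ?_⟩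
      simp
      linear_combination (Polynomial.aeval b p) * ha
    · refine ⟨g * X 1, p * Polynomial.X, ?_⟩
      simp
      ring
    · obtain ⟨p', hp'⟩ := sub_one_mul_aeval_pair (b := b) ha g
      refine ⟨g, p' - p, ?_⟩
      simp
      linear_combination hp' + (Polynomial.aeval b p) * hq

end

/-- Let `A = ℤ[s₁,s₂,q]/(q² - 1, (q - 1)s₁)` and `f : A → ℤ[z,t]` the ring map with
`s₁ ↦ z + t`, `s₂ ↦ z·t`, `q ↦ 1`.  Then `p(x) ↦ (q - 1)·p(s₂)` is an injective
`ℤ`-linear map `ℤ[x] → A` whose image is exactly `ker f`.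
(Here `s₁ = X 0`, `s₂ = X 1`, `q = X 2`, `z = X 0`, `t = X 1`.) -/
theorem ker_restriction_SU3 :
    ∀ (f : (MvPolynomial (Fin 3) ℤ ⧸
        (Ideal.span {(X 2 : MvPolynomial (Fin 3) ℤ) ^ 2 - 1,
          ((X 2 : MvPolynomial (Fin 3) ℤ) - 1) * X 0})) →+* MvPolynomial (Fin 2) ℤ),
      f (Ideal.Quotient.mk _ (X 0)) = X 0 + X 1 →
      f (Ideal.Quotient.mk _ (X 1)) = X 0 * X 1 →
      f (Ideal.Quotient.mk _ (X 2)) = 1 →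
      IsLinearMap ℤ (fun p : Polynomial ℤ =>
        (Ideal.Quotient.mk (Ideal.span {(X 2 : MvPolynomial (Fin 3) ℤ) ^ 2 - 1,
            ((X 2 : MvPolynomial (Fin 3) ℤ) - 1) * X 0}) (X 2) - 1) *
          Polynomial.aeval (Ideal.Quotient.mk _ (X 1)) p) ∧
      Function.Injective (fun p : Polynomial ℤ =>
        (Ideal.Quotient.mk (Ideal.span {(X 2 : MvPolynomial (Fin 3) ℤ) ^ 2 - 1,
            ((X 2 : MvPolynomial (Fin 3) ℤ) - 1) * X 0}) (X 2) - 1) *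
          Polynomial.aeval (Ideal.Quotient.mk _ (X 1)) p) ∧
      ∀ x, x ∈ RingHom.ker f ↔
        ∃ p : Polynomial ℤ,
          (Ideal.Quotient.mk (Ideal.span {(X 2 : MvPolynomial (Fin 3) ℤ) ^ 2 - 1,
              ((X 2 : MvPolynomial (Fin 3) ℤ) - 1) * X 0}) (X 2) - 1) *
            Polynomial.aeval (Ideal.Quotient.mk _ (X 1)) p = x := by
  generalize hI : Ideal.span {(X 2 : MvPolynomial (Fin 3) ℤ) ^ 2 - 1,
    ((X 2 : MvPolynomial (Fin 3) ℤ) - 1) * X 0} = I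
  intro f h0 h1 h2
  have hq : Ideal.Quotient.mk I (X 2) ^ 2 - 1 = 0 := by
    rw [← map_pow, ← map_one (Ideal.Quotient.mk I), ← map_sub, Ideal.Quotient.eq_zero_iff_mem]
    exact hI ▸ Ideal.subset_span (by simp)
  have ha : (Ideal.Quotient.mk I (X 2) - 1) * Ideal.Quotient.mk I (X 0) = 0 := by
    rw [← map_one (Ideal.Quotient.mk I), ← map_sub, ← map_mul, Ideal.Quotient.eq_zero_iff_mem]
    exact hI ▸ Ideal.subset_span (by simp)
  refine ⟨⟨fun p p' => by simp only [map_add, mul_add],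
    fun c p => by simp only [map_zsmul, mul_smul_comm]⟩, ?_, fun x => ⟨fun hx => ?_, ?_⟩⟩
  · let φ : MvPolynomial (Fin 3) ℤ →+* Polynomial ℤ :=
      (aeval ![(0 : Polynomial ℤ), Polynomial.X, -1]).toRingHom
    have hφ : ∀ y ∈ I, φ y = 0 := by
      change I ≤ RingHom.ker φ
      rw [← hI, Ideal.span_le]
      rintro y (rfl | rfl) <;> simp [φ, RingHom.mem_ker]
    let ψ := Ideal.Quotient.lift I φ hφ
    have hψ : ∀ p : Polynomial ℤ,
        ψ ((Ideal.Quotient.mk I (X 2) - 1) *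
          Polynomial.aeval (Ideal.Quotient.mk I (X 1)) p) = -2 * p := by
      intro p
      have hp : ψ (Polynomial.aeval (Ideal.Quotient.mk I (X 1)) p) = p := by
        have hX : ψ (Ideal.Quotient.mk I (X 1)) = Polynomial.X := by simp [ψ, φ]
        rw [Polynomial.aeval_def, Polynomial.hom_eval₂, hX,
          RingHom.ext_int (ψ.comp _) Polynomial.C, Polynomial.eval₂_C_X]
      have h2 : ψ (Ideal.Quotient.mk I (X 2)) = -1 := by simp [ψ, φ]
      rw [map_mul, hp, map_sub, h2, map_one]
      ring
    intro p p' h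
    have := congrArg ψ h
    simp only [hψ] at this
    exact mul_left_cancel₀ (neg_ne_zero.mpr two_ne_zero) this
  · obtain ⟨P, rfl⟩ := Ideal.Quotient.mk_surjective x
    have hP : Ideal.Quotient.mk I P = aeval ![Ideal.Quotient.mk I (X 0),
        Ideal.Quotient.mk I (X 1), Ideal.Quotient.mk I (X 2)] P := by
      rw [← Ideal.Quotient.mkₐ_eq_mk ℤ]
      refine congrArg (fun F : MvPolynomial (Fin 3) ℤ →ₐ[ℤ] _ => F P) (algHom_ext ?_)
      intro i
      fin_cases i <;> simp
    obtain ⟨g, p, h⟩ := exists_aeval_triple_eq (b := Ideal.Quotient.mk I (X 1)) hq ha P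
    rw [← hP] at h
    have hg : f (aeval ![Ideal.Quotient.mk I (X 0), Ideal.Quotient.mk I (X 1)] g) =
        aeval ![(X 0 + X 1 : MvPolynomial (Fin 2) ℤ), X 0 * X 1] g := by
      refine congrArg (fun F : MvPolynomial (Fin 2) ℤ →+* _ => F g)
        (ringHom_ext (f := f.comp (aeval _).toRingHom) (g := (aeval _).toRingHom) ?_ ?_)
      · intro r
        simp
      · intro i
        fin_cases i <;> simp [h0, h1]
    have hg0 : g = 0 := by
      apply injective_aeval_add_mul ℤ
      rw [map_zero, ← hg]
      rw [RingHom.mem_ker, h, map_add, map_mul, map_sub, h2, map_one, sub_self, zero_mul,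
        add_zero] at hx
      exact hx
    exact ⟨p, by rw [h, hg0, map_zero, zero_add]⟩
  · rintro ⟨p, rfl⟩
    rw [RingHom.mem_ker, map_mul, map_sub, h2, map_one, sub_self, zero_mul]
end
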